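/- Let q₀, h₀, D∞, σ, ρ, c, γ be positive constants and ε ∈ (0,1). Then there exist l > 0 and k > 0 satisfying, with α = k/(ρc), the system (E1): q₀/(ρ l) = [σ + (γ k (1−ε)/(2q₀))·exp(σ²/α)]·exp(σ²/α) and (E2): erf(σ/√α) = (k D∞/(q₀√(απ)))(1 − q₀/(h₀ D∞)), if and only if (R2) holds: 0 < 1 − q₀/(h₀D∞). In that case the solution is unique and is given by k = ρc(σ/ξ)² and l = (q₀/(ρσ))·exp(−ξ²) / (1 + (ρcσγ(1−ε)/(2q₀))·exp(ξ²)/ξ²), where ξ is the unique positive solution of ξ·erf(ξ) = (σρcD∞/(q₀√π))(1 − q₀/(h₀D∞)). -/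

import Mathlib

open Real Set

/-- The Gauss error function `erf z = (2/√π) ∫₀ᶻ exp(−s²) ds`. -/
noncomputable def erf (z : ℝ) : ℝ := 2 / Real.sqrt π * ∫ s in (0:ℝ)..z, Real.exp (-s ^ 2)

/-- Equation (E1) of the paper, with `α = k/(ρc)`. -/
def eqE1 (q₀ σ l k ρ c γ ε : ℝ) : Prop :=
  q₀ / (ρ * l) =
    (σ + γ * k * (1 - ε) / (2 * q₀) * Real.exp (σ ^ 2 / (k / (ρ * c)))) *
      Real.exp (σ ^ 2 / (k / (ρ * c)))

/-- Equation (E2) of the paper, with `α = k/(ρc)`. -/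
def eqE2 (q₀ h₀ D σ k ρ c : ℝ) : Prop :=
  erf (σ / Real.sqrt (k / (ρ * c))) =
    k * D / (q₀ * Real.sqrt (k / (ρ * c) * π)) * (1 - q₀ / (h₀ * D))

lemma continuous_exp_neg_sq : Continuous fun s : ℝ => Real.exp (-s ^ 2) := by fun_prop

lemma continuous_erf : Continuous erf :=
  continuous_const.mul (intervalIntegral.continuous_primitive
    (fun a b => continuous_exp_neg_sq.intervalIntegrable a b) 0)

lemma strictMono_erf : StrictMono erf := by
  intro a b hab
  have hpos : 0 < ∫ s in a..b, Real.exp (-s ^ 2) :=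
    intervalIntegral.intervalIntegral_pos_of_pos
      (continuous_exp_neg_sq.intervalIntegrable a b) (fun _ => Real.exp_pos _) hab
  have hadd := intervalIntegral.integral_add_adjacent_intervals
    (continuous_exp_neg_sq.intervalIntegrable (μ := MeasureTheory.volume) 0 a)
    (continuous_exp_neg_sq.intervalIntegrable a b)
  have hc : 0 < 2 / Real.sqrt π := by positivity
  exact mul_lt_mul_of_pos_left (by linarith) hc

lemma erf_zero : erf 0 = 0 := by simp [erf]

lemma erf_pos {x : ℝ} (hx : 0 < x) : 0 < erf x := erf_zero ▸ strictMono_erf hx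

lemma strictMonoOn_mul_erf : StrictMonoOn (fun x => x * erf x) (Ioi 0) :=
  fun _ hx _ _ hxy => mul_lt_mul'' hxy (strictMono_erf hxy) (le_of_lt hx) (erf_pos hx).le

/-- The function `x ↦ x * erf x` takes every positive value on `(0, ∞)`. -/
lemma exists_pos_mul_erf_eq {A : ℝ} (hA : 0 < A) : ∃ x, 0 < x ∧ x * erf x = A := by
  have h1 : 0 < erf 1 := erf_pos one_pos
  have hb : 0 ≤ 1 + A / erf 1 := by positivity
  have hle : A ≤ (1 + A / erf 1) * erf (1 + A / erf 1) := by
    have hmono : erf 1 ≤ erf (1 + A / erf 1) :=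
      strictMono_erf.monotone (le_add_of_nonneg_right (by positivity))
    calc A ≤ (1 + A / erf 1) * erf 1 := by
          rw [add_mul, div_mul_cancel₀ _ h1.ne']; linarith
      _ ≤ _ := mul_le_mul_of_nonneg_left hmono hb
  obtain ⟨x, hx, hxA⟩ := intermediate_value_Icc hb
    (continuous_id.mul continuous_erf).continuousOn
    (show A ∈ Icc _ _ from ⟨by simpa using hA.le, hle⟩)
  refine ⟨x, lt_of_le_of_ne hx.1 ?_, hxA⟩
  rintro rfl
  simp at hxA
  exact hA.ne hxA

/-- Equation (E2) in terms of the similarity parameter `ξ`. -/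
lemma eqE2_iff {q₀ h₀ D σ ρ c ξ : ℝ} (hq : 0 < q₀) (hσ : 0 < σ) (hρ : 0 < ρ) (hc : 0 < c)
    (hξ : 0 < ξ) :
    eqE2 q₀ h₀ D σ (ρ * c * (σ / ξ) ^ 2) ρ c ↔
      ξ * erf ξ = σ * ρ * c * D / (q₀ * Real.sqrt π) * (1 - q₀ / (h₀ * D)) := by
  have hα : ρ * c * (σ / ξ) ^ 2 / (ρ * c) = (σ / ξ) ^ 2 := by field_simp
  have hs : 0 ≤ σ / ξ := by positivity
  have hπ : 0 < Real.sqrt π := by positivity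
  have hσξ : σ / (σ / ξ) = ξ := by field_simp
  have hr : ρ * c * (σ / ξ) ^ 2 * D / (q₀ * (σ / ξ * Real.sqrt π)) * (1 - q₀ / (h₀ * D)) =
      σ * ρ * c * D / (q₀ * Real.sqrt π) * (1 - q₀ / (h₀ * D)) / ξ := by
    generalize 1 - q₀ / (h₀ * D) = w
    field_simp
  rw [eqE2, hα, Real.sqrt_mul (sq_nonneg _), Real.sqrt_sq hs, hσξ, hr, eq_div_iff hξ.ne',
    mul_comm]

/-- Equation (E1) in terms of the similarity parameter `ξ`, solved for `l`. -/
lemma eqE1_iff {q₀ σ l ρ c γ ε ξ : ℝ} (hq : 0 < q₀) (hσ : 0 < σ) (hρ : 0 < ρ) (hc : 0 < c)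
    (hγ : 0 < γ) (hε : 0 < 1 - ε) (hξ : 0 < ξ) (hl : 0 < l) :
    eqE1 q₀ σ l (ρ * c * (σ / ξ) ^ 2) ρ c γ ε ↔
      l = q₀ / (ρ * σ) * Real.exp (-ξ ^ 2) /
        (1 + ρ * c * σ * γ * (1 - ε) / (2 * q₀) * Real.exp (ξ ^ 2) / ξ ^ 2) := by
  have hα : σ ^ 2 / (ρ * c * (σ / ξ) ^ 2 / (ρ * c)) = ξ ^ 2 := by field_simp
  have hE := Real.exp_pos (ξ ^ 2)
  rw [eqE1, hα, Real.exp_neg]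
  generalize Real.exp (ξ ^ 2) = E at *
  generalize 1 - ε = e at *
  have hB : 0 < 1 + ρ * c * σ * γ * e / (2 * q₀) * E / ξ ^ 2 := by positivity
  have hfac : (σ + γ * (ρ * c * (σ / ξ) ^ 2) * e / (2 * q₀) * E) * E =
      σ * E * (1 + ρ * c * σ * γ * e / (2 * q₀) * E / ξ ^ 2) := by
    field_simp
  rw [hfac]
  generalize 1 + ρ * c * σ * γ * e / (2 * q₀) * E / ξ ^ 2 = B at *
  rw [div_eq_iff (by positivity), eq_div_iff hB.ne', ← div_eq_mul_inv, div_div,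
    eq_div_iff (by positivity)]
  constructor <;> intro h <;> linarith

/-- Every positive `k` arises from a positive similarity parameter. -/
lemma exists_similarity_parameter {σ ρ c k : ℝ} (hσ : 0 < σ) (hρ : 0 < ρ) (hc : 0 < c)
    (hk : 0 < k) : ∃ ξ, 0 < ξ ∧ k = ρ * c * (σ / ξ) ^ 2 := by
  have hα : 0 < k / (ρ * c) := by positivity
  refine ⟨σ / Real.sqrt (k / (ρ * c)), by positivity, ?_⟩
  rw [div_div_cancel₀ hσ.ne', Real.sq_sqrt hα.le]
  field_simp

/-- Case 10 (determination of `l` and `k`): there exist `l > 0` and `k > 0` satisfying the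
system (E1)–(E2) iff (R2) `0 < 1 − q₀/(h₀D∞)` holds; in that case the solution is unique and
given by `k = ρc(σ/ξ)²` and `l = (q₀/(ρσ))·exp(−ξ²)/(1 + (ρcσγ(1−ε)/(2q₀))·exp(ξ²)/ξ²)`,
where `ξ` is the unique positive solution of `ξ·erf(ξ) = (σρcD∞/(q₀√π))(1 − q₀/(h₀D∞))`. -/
theorem case10_l_k (q₀ h₀ D σ ρ c γ ε : ℝ)
    (hq : 0 < q₀) (hh : 0 < h₀) (hD : 0 < D) (hσ : 0 < σ)
    (hρ : 0 < ρ) (hc : 0 < c) (hγ : 0 < γ) (hε : ε ∈ Set.Ioo (0:ℝ) 1) :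
    ((∃ l k : ℝ, 0 < l ∧ 0 < k ∧ eqE1 q₀ σ l k ρ c γ ε ∧ eqE2 q₀ h₀ D σ k ρ c)
      ↔ 0 < 1 - q₀ / (h₀ * D)) ∧
    (0 < 1 - q₀ / (h₀ * D) →
      ∀ ξ : ℝ, 0 < ξ →
        ξ * erf ξ = σ * ρ * c * D / (q₀ * Real.sqrt π) * (1 - q₀ / (h₀ * D)) →
        ∀ l k : ℝ, 0 < l → 0 < k →
          ((eqE1 q₀ σ l k ρ c γ ε ∧ eqE2 q₀ h₀ D σ k ρ c) ↔
            (k = ρ * c * (σ / ξ) ^ 2 ∧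
             l = q₀ / (ρ * σ) * Real.exp (-ξ ^ 2) /
                   (1 + ρ * c * σ * γ * (1 - ε) / (2 * q₀) * Real.exp (ξ ^ 2) / ξ ^ 2)))) := by
  have hε' : 0 < 1 - ε := sub_pos.2 hε.2
  have hA : 0 < σ * ρ * c * D / (q₀ * Real.sqrt π) := by positivity
  refine ⟨⟨?_, fun hR => ?_⟩, fun _ ξ hξ hξA l k hl hk => ⟨?_, ?_⟩⟩
  · rintro ⟨l, k, -, hk, -, h2⟩
    obtain ⟨ξ, hξ, rfl⟩ := exists_similarity_parameter hσ hρ hc hk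
    have hpos := mul_pos hξ (erf_pos hξ)
    rw [(eqE2_iff hq hσ hρ hc hξ).1 h2] at hpos
    exact pos_of_mul_pos_right hpos hA.le
  · obtain ⟨ξ, hξ, hξA⟩ := exists_pos_mul_erf_eq (mul_pos hA hR)
    exact ⟨_, ρ * c * (σ / ξ) ^ 2, by positivity, by positivity,
      (eqE1_iff hq hσ hρ hc hγ hε' hξ (by positivity)).2 rfl,
      (eqE2_iff hq hσ hρ hc hξ).2 hξA⟩
  · rintro ⟨h1, h2⟩
    obtain ⟨η, hη, rfl⟩ := exists_similarity_parameter hσ hρ hc hk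
    obtain rfl : η = ξ := strictMonoOn_mul_erf.injOn hη hξ
      (((eqE2_iff hq hσ hρ hc hη).1 h2).trans hξA.symm)
    exact ⟨rfl, (eqE1_iff hq hσ hρ hc hγ hε' hξ hl).1 h1⟩
  · rintro ⟨rfl, h⟩
    exact ⟨(eqE1_iff hq hσ hρ hc hγ hε' hξ hl).2 h, (eqE2_iff hq hσ hρ hc hξ).2 hξA⟩
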